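/- Let p ∈ ℝ and f(x) = det(−x)^{−p} for x ∈ −Π_m. For a ∈ −Π_m and v₁,…,v_N ∈ Sym(m,ℝ), the iterated directional derivative D_{v₁}⋯D_{v_N} f(a) equals f(a) · Σ_{π ∈ S_N} p^{#C(π)} ∏_{c ∈ C(π)} tr(∏_{j ∈ c} (−a)^{−1} v_j), where C(π) is the set of cycles of the permutation π and the product inside the trace is taken over the cycle c in cyclic order. -/

import Mathlib

open Matrix Real

/-- The number of cycles of a permutation, counting fixed points as cycles of
length one. -/
noncomputable def cycleCount {N : ℕ} (σ : Equiv.Perm (Fin N)) : ℕ :=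
  σ.cycleFactorsFinset.card + (Finset.univ.filter fun j => σ j = j).card

/-- `∏_{c ∈ C(σ)} tr(∏_{j ∈ c} M j)`, the product over all cycles `c` of `σ` of
the trace of the product of the `M j`, `j ∈ c`, taken in cyclic order. -/
noncomputable def cycleTraceProd {N m : ℕ} (M : Fin N → Matrix (Fin m) (Fin m) ℝ)
    (σ : Equiv.Perm (Fin N)) : ℝ :=
  (∏ j ∈ Finset.univ.filter (fun j => σ j = j), (M j).trace) *
    ∏ c ∈ σ.cycleFactorsFinset,
      if h : c.support.Nonempty then
        (((List.range c.support.card).map fun i => M ((c ^ i) (c.support.min' h))).prod).trace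
      else 1


theorem aux_block {N m : ℕ} {ι : Type*} [Fintype ι] [DecidableEq ι] (κ : Fin N → ι)
    (W : ∀ b : ι, ({j // κ j = b} → Fin m) → ℝ) :
    ∑ k : Fin N → Fin m, ∏ b, W b (fun j => k j.1) = ∏ b, ∑ k, W b k := by
  rw [Finset.prod_univ_sum, Fintype.piFinset_univ]
  refine Fintype.sum_equiv
    ((Equiv.arrowCongr (Equiv.sigmaFiberEquiv κ).symm (Equiv.refl (Fin m))).trans
      (Equiv.piCurry (fun (_ : ι) _ => Fin m))) _ _ ?_
  intro k
  rfl

theorem aux_list {m : ℕ} (r : ℕ) (F : ℕ → Matrix (Fin m) (Fin m) ℝ) (a b : Fin m) :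
    (((List.range (r + 1)).map F).prod) a b =
      ∑ k : Fin r → Fin m, ∏ i : Fin (r + 1),
        F i ((Fin.cons a k : Fin (r + 1) → Fin m) i) ((Fin.snoc k b : Fin (r + 1) → Fin m) i) := by
  induction r generalizing F a with
  | zero => simp [Fin.snoc]
  | succ r ih =>
    rw [List.range_succ_eq_map, List.map_cons, List.prod_cons, List.map_map, Matrix.mul_apply,
      ← (Fin.consEquiv (fun _ : Fin (r + 1) => Fin m)).sum_comp, Fintype.sum_prod_type]
    refine Finset.sum_congr rfl fun c _ => ?_
    rw [ih, Finset.mul_sum]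
    refine Finset.sum_congr rfl fun k _ => ?_
    rw [Fin.prod_univ_succ (n := r + 1)]
    simp [Fin.consEquiv, ← Fin.cons_snoc_eq_snoc_cons]

theorem aux_trace {m : ℕ} (r : ℕ) (F : ℕ → Matrix (Fin m) (Fin m) ℝ) :
    (((List.range (r + 1)).map F).prod).trace =
      ∑ k : Fin (r + 1) → Fin m, ∏ i : Fin (r + 1), F i (k i) (k (i + 1)) := by
  rw [← (Fin.consEquiv (fun _ : Fin (r + 1) => Fin m)).sum_comp, Fintype.sum_prod_type,
    Matrix.trace]
  refine Finset.sum_congr rfl fun c _ => ?_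
  rw [Matrix.diag_apply, aux_list]
  refine Finset.sum_congr rfl fun k _ => ?_
  refine Finset.prod_congr rfl fun i _ => ?_
  congr 1
  refine Fin.lastCases ?_ (fun i => ?_) i
  · simp [Fin.consEquiv]
  · rw [Fin.snoc_castSucc, Fin.coeSucc_eq_succ]
    simp [Fin.consEquiv]

theorem aux_cycle {N m : ℕ} (M : Fin N → Matrix (Fin m) (Fin m) ℝ) (σ : Equiv.Perm (Fin N))
    (c : Equiv.Perm (Fin N)) (hc : c ∈ σ.cycleFactorsFinset) (P : Fin N → Prop) [DecidablePred P]
    (hP : ∀ j, P j ↔ j ∈ c.support) (hσ : ∀ j, P j → P (σ j)) (h : c.support.Nonempty) :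
    ∑ k : {j // P j} → Fin m, ∏ j : {j // P j}, M j.1 (k j) (k ⟨σ j.1, hσ _ j.2⟩)
      = (((List.range c.support.card).map fun i =>
          M ((c ^ i) (c.support.min' h))).prod).trace := by
  obtain ⟨hcyc, hcs⟩ := Equiv.Perm.mem_cycleFactorsFinset_iff.1 hc
  obtain ⟨r, hr⟩ : ∃ r, c.support.card = r + 1 :=
    ⟨c.support.card - 1, by have := h.card_pos; omega⟩
  have hon : c.IsCycleOn (c.support : Set (Fin N)) := by
    have := hcyc.isCycleOn
    convert this using 1
    ext; simp
  set x := c.support.min' h with hx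
  have hxs : x ∈ c.support := Finset.min'_mem _ _
  have hmem : ∀ i : ℕ, (c ^ i) x ∈ c.support := fun i => by
    rw [Equiv.Perm.pow_apply_mem_support]; exact hxs
  let g : Fin (r + 1) → {j // P j} := fun i => ⟨(c ^ (i : ℕ)) x, (hP _).2 (hmem i)⟩
  have hg : Function.Bijective g := by
    constructor
    · intro i j hij
      have : (c ^ (i : ℕ)) x = (c ^ (j : ℕ)) x := congrArg Subtype.val hij
      rw [hon.pow_apply_eq_pow_apply hxs, hr] at this
      exact Fin.ext (Nat.ModEq.eq_of_lt_of_lt this i.2 j.2)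
    · rintro ⟨y, hy⟩
      obtain ⟨n, hn, hn'⟩ := hon.exists_pow_eq hxs ((hP _).1 hy)
      exact ⟨⟨n, hr ▸ hn⟩, Subtype.ext hn'⟩
  have hgs : ∀ i : Fin (r + 1), (⟨σ (g i).1, hσ _ (g i).2⟩ : {j // P j}) = g (i + 1) := by
    intro i
    apply Subtype.ext
    change σ ((c ^ (i : ℕ)) x) = (c ^ ((i + 1 : Fin (r + 1)) : ℕ)) x
    rw [← hcs _ (hmem i), ← Equiv.Perm.mul_apply, ← pow_succ',
      hon.pow_apply_eq_pow_apply hxs, hr, Fin.val_add_eq_ite]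
    have := i.2
    rcases Nat.eq_zero_or_pos r with h0 | h0
    · subst h0; simp [Nat.ModEq]
    · have h1 : ((1 : Fin (r + 1)) : ℕ) = 1 := by
        rw [Fin.val_one']; exact Nat.mod_eq_of_lt (by omega)
      rw [h1]
      split_ifs with h2
      · simp [Nat.ModEq, Nat.mod_eq_sub_mod h2]
      · rfl
  rw [hr, aux_trace]
  let e := Equiv.ofBijective g hg
  refine Fintype.sum_equiv (Equiv.arrowCongr e.symm (Equiv.refl _)) _ _ fun k => ?_
  rw [← e.prod_comp]
  refine Finset.prod_congr rfl fun i _ => ?_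
  have := hgs i
  change M (g i).1 (k (g i)) (k ⟨σ (g i).1, hσ _ (g i).2⟩) = M (g i).1 (k (g i)) (k (g (i + 1)))
  rw [hgs]

theorem aux_ctp {N m : ℕ} (M : Fin N → Matrix (Fin m) (Fin m) ℝ) (σ : Equiv.Perm (Fin N)) :
    cycleTraceProd M σ = ∑ k : Fin N → Fin m, ∏ j, M j (k j) (k (σ j)) := by
  classical
  let κ : Fin N → Fin N ⊕ Equiv.Perm (Fin N) :=
    fun j => if σ j = j then Sum.inl j else Sum.inr (σ.cycleOf j)
  have hκ : ∀ j, κ (σ j) = κ j := by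
    intro j
    by_cases hj : σ j = j
    · rw [hj]
    · have : σ (σ j) ≠ σ j := fun h => hj (σ.injective h)
      simp only [κ, if_neg hj, if_neg this, Equiv.Perm.cycleOf_self_apply]
  have hb := aux_block (m := m) κ
    (fun b k => ∏ j : {j // κ j = b}, M j.1 (k j) (k ⟨σ j.1, (hκ _).trans j.2⟩))
  have hl : ∀ k : Fin N → Fin m, ∏ b, ∏ j : {j // κ j = b}, M j.1 (k j.1) (k (σ j.1))
      = ∏ j, M j (k j) (k (σ j)) := fun k =>
    Fintype.prod_fiberwise (g := κ) (fun j => M j (k j) (k (σ j)))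
  simp only [hl] at hb
  rw [hb, Fintype.prod_sum_type, cycleTraceProd]
  congr 1
  · rw [Finset.prod_filter]
    refine Finset.prod_congr rfl fun j _ => ?_
    split_ifs with hj
    · have hu : ∀ i : {i // κ i = Sum.inl j}, i = ⟨j, by simp [κ, hj]⟩ := by
        rintro ⟨i, hi⟩
        simp only [κ] at hi
        split_ifs at hi
        · simpa using hi
      let _ : Unique {i // κ i = Sum.inl j} := ⟨⟨⟨j, by simp [κ, hj]⟩⟩, hu⟩
      rw [← (Equiv.funUnique {i // κ i = Sum.inl j} (Fin m)).symm.sum_comp]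
      simp only [Matrix.trace, Fintype.prod_unique]
      rfl
    · have : IsEmpty {i // κ i = Sum.inl j} := by
        constructor
        rintro ⟨i, hi⟩
        simp only [κ] at hi
        split_ifs at hi with h1
        · simp at hi; subst hi; exact hj h1
      simp
  · have key : ∀ c ∈ σ.cycleFactorsFinset, ∀ j, κ j = Sum.inr c ↔ j ∈ c.support := by
      intro c hc j
      obtain ⟨hcyc, hcs⟩ := Equiv.Perm.mem_cycleFactorsFinset_iff.1 hc
      constructor
      · intro h
        simp only [κ] at h
        split_ifs at h with h1
        simp at h
        subst h
        simpa [Equiv.Perm.mem_support] using h1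
      · intro h
        have h1 := Equiv.Perm.cycle_is_cycleOf h hc
        have h2 : σ j ≠ j := by
          rw [← hcs _ h]; exact Equiv.Perm.mem_support.1 h
        simp [κ, h2, h1]
    rw [← Finset.prod_subset (Finset.subset_univ σ.cycleFactorsFinset)]
    · refine Finset.prod_congr rfl fun c hc => ?_
      have hne : c.support.Nonempty := by
        rw [Finset.nonempty_iff_ne_empty, Ne, Equiv.Perm.support_eq_empty_iff]
        exact (Equiv.Perm.mem_cycleFactorsFinset_iff.1 hc).1.ne_one
      rw [dif_pos hne]
      exact (aux_cycle M σ c hc (fun j => κ j = Sum.inr c) (key c hc)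
        (fun j hj => (hκ j).trans hj) hne).symm
    · intro c _ hc
      have : IsEmpty {i // κ i = Sum.inr c} := by
        constructor
        rintro ⟨i, hi⟩
        simp only [κ] at hi
        split_ifs at hi with h1
        simp at hi
        subst hi
        exact hc (Equiv.Perm.cycleOf_mem_cycleFactorsFinset_iff.2 (Equiv.Perm.mem_support.2 h1))
      simp

theorem aux_count {N m : ℕ} (σ : Equiv.Perm (Fin N)) :
    cycleTraceProd (fun _ => (1 : Matrix (Fin m) (Fin m) ℝ)) σ = (m : ℝ) ^ cycleCount σ := by
  rw [cycleTraceProd, cycleCount, pow_add, mul_comm]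
  congr 1
  · rw [← Finset.prod_const]
    refine Finset.prod_congr rfl fun c hc => ?_
    have hne : c.support.Nonempty := by
      rw [Finset.nonempty_iff_ne_empty, Ne, Equiv.Perm.support_eq_empty_iff]
      exact (Equiv.Perm.mem_cycleFactorsFinset_iff.1 hc).1.ne_one
    rw [dif_pos hne]
    simp
  · simp

theorem aux_ctp' {N m : ℕ} (M : Fin N → Matrix (Fin m) (Fin m) ℝ) (σ : Equiv.Perm (Fin N)) :
    cycleTraceProd M σ = ∑ k : Fin N → Fin m, ∏ j, M j (k (σ⁻¹ j)) (k j) := by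
  rw [aux_ctp]
  refine Fintype.sum_equiv (Equiv.arrowCongr σ⁻¹ (Equiv.refl _)) _ _ fun k => ?_
  refine Finset.prod_congr rfl fun j _ => ?_
  change M j (k j) (k (σ j)) = M j (k (σ (σ⁻¹ j))) (k (σ j))
  simp

theorem aux_ctp_zero {n m : ℕ} (M : Fin (n + 1) → Matrix (Fin m) (Fin m) ℝ)
    (σ : Equiv.Perm (Fin n)) :
    cycleTraceProd M (Equiv.Perm.decomposeFin.symm (0, σ)) =
      (M 0).trace * cycleTraceProd (fun j => M j.succ) σ := by
  rw [aux_ctp, aux_ctp, ← (Fin.consEquiv (fun _ : Fin (n + 1) => Fin m)).sum_comp,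
    Fintype.sum_prod_type, Matrix.trace, Finset.sum_mul_sum]
  refine Finset.sum_congr rfl fun c _ => Finset.sum_congr rfl fun k _ => ?_
  simp [Fin.prod_univ_succ, Fin.consEquiv]

theorem aux_inv_zero {n : ℕ} (σ : Equiv.Perm (Fin n)) (j : Fin n) :
    (Equiv.Perm.decomposeFin.symm (j.succ, σ))⁻¹ 0 = (σ⁻¹ j).succ := by
  rw [Equiv.Perm.inv_eq_iff_eq]; simp

theorem aux_inv_self {n : ℕ} (σ : Equiv.Perm (Fin n)) (j : Fin n) :
    (Equiv.Perm.decomposeFin.symm (j.succ, σ))⁻¹ j.succ = 0 := by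
  rw [Equiv.Perm.inv_eq_iff_eq]; simp

theorem aux_inv_ne {n : ℕ} (σ : Equiv.Perm (Fin n)) (j i : Fin n) (h : i ≠ j) :
    (Equiv.Perm.decomposeFin.symm (j.succ, σ))⁻¹ i.succ = (σ⁻¹ i).succ := by
  rw [Equiv.Perm.inv_eq_iff_eq, Equiv.Perm.decomposeFin_symm_apply_succ]
  have e : σ (σ⁻¹ i) = i := by simp
  rw [e]
  rw [Equiv.swap_apply_of_ne_of_ne (Fin.succ_ne_zero _) (by simpa using h)]

theorem aux_ctp_succ {n m : ℕ} (M : Fin (n + 1) → Matrix (Fin m) (Fin m) ℝ)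
    (σ : Equiv.Perm (Fin n)) (j : Fin n) :
    cycleTraceProd M (Equiv.Perm.decomposeFin.symm (j.succ, σ)) =
      cycleTraceProd (Function.update (fun j => M j.succ) j (M 0 * M j.succ)) σ := by
  rw [aux_ctp', aux_ctp', ← (Fin.consEquiv (fun _ : Fin (n + 1) => Fin m)).sum_comp,
    Fintype.sum_prod_type, Finset.sum_comm]
  refine Finset.sum_congr rfl fun k _ => ?_
  rw [← Finset.mul_prod_erase Finset.univ _ (Finset.mem_univ j), Function.update_self,
    Matrix.mul_apply, Finset.sum_mul]
  refine Finset.sum_congr rfl fun c _ => ?_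
  rw [Fin.prod_univ_succ, ← Finset.mul_prod_erase Finset.univ _ (Finset.mem_univ j),
    aux_inv_zero, aux_inv_self, ← mul_assoc]
  congr 1
  refine Finset.prod_congr rfl fun i hi => ?_
  have hij : i ≠ j := (Finset.mem_erase.1 hi).1
  rw [aux_inv_ne _ _ _ hij, Function.update_of_ne hij]
  simp [Fin.consEquiv]

theorem aux_count_zero {n : ℕ} (σ : Equiv.Perm (Fin n)) :
    cycleCount (Equiv.Perm.decomposeFin.symm (0, σ)) = cycleCount σ + 1 := by
  have h := aux_ctp_zero (m := 2) (fun _ => 1) σ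
  rw [aux_count, aux_count, Matrix.trace_one, Fintype.card_fin, ← pow_succ'] at h
  exact_mod_cast Nat.pow_right_injective le_rfl (by exact_mod_cast h)

theorem aux_count_succ {n : ℕ} (σ : Equiv.Perm (Fin n)) (j : Fin n) :
    cycleCount (Equiv.Perm.decomposeFin.symm (j.succ, σ)) = cycleCount σ := by
  have h := aux_ctp_succ (m := 2) (fun _ => 1) σ j
  rw [mul_one, Function.update_eq_self_iff.2 rfl, aux_count, aux_count] at h
  exact_mod_cast Nat.pow_right_injective le_rfl (by exact_mod_cast h)

noncomputable def auxG {n m : ℕ} (p : ℝ) (M : Fin n → Matrix (Fin m) (Fin m) ℝ) : ℝ :=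
  ∑ σ : Equiv.Perm (Fin n), p ^ cycleCount σ * cycleTraceProd M σ

theorem auxG_succ {n m : ℕ} (p : ℝ) (M : Fin (n + 1) → Matrix (Fin m) (Fin m) ℝ) :
    auxG p M = p * (M 0).trace * auxG p (fun j => M j.succ) +
      ∑ j : Fin n, auxG p (Function.update (fun j => M j.succ) j (M 0 * M j.succ)) := by
  rw [auxG, ← Equiv.Perm.decomposeFin.symm.sum_comp, Fintype.sum_prod_type, Fin.sum_univ_succ]
  simp only [auxG, aux_ctp_zero, aux_ctp_succ, aux_count_zero, aux_count_succ, Finset.mul_sum]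
  congr 1
  refine Finset.sum_congr rfl fun σ _ => ?_
  ring

theorem aux_det_deriv {m : ℕ} (X w : Matrix (Fin m) (Fin m) ℝ) (hX : X.det ≠ 0) :
    HasDerivAt (fun s : ℝ => (X - s • w).det) (-(X.det * (X⁻¹ * w).trace)) 0 := by
  have h1 : ∀ s : ℝ, (X - s • w).det =
      X.det * (det (1 + (Polynomial.X : Polynomial ℝ) •
        (-(X⁻¹ * w)).map Polynomial.C)).eval s := by
    intro s
    rw [← Polynomial.coe_evalRingHom, RingHom.map_det, ← Matrix.det_mul]
    congr 1
    have : (Polynomial.evalRingHom s).mapMatrix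
        (1 + (Polynomial.X : Polynomial ℝ) • (-(X⁻¹ * w)).map Polynomial.C)
        = 1 - s • (X⁻¹ * w) := by
      ext i j
      by_cases hij : i = j
      · subst hij; simp; ring
      · simp [Matrix.one_apply_ne hij]; ring
    rw [this, mul_sub, mul_one, Matrix.mul_smul, ← mul_assoc,
      Matrix.mul_nonsing_inv _ (isUnit_iff_ne_zero.2 hX), one_mul]
  have h2 := ((det (1 + (Polynomial.X : Polynomial ℝ) •
        (-(X⁻¹ * w)).map Polynomial.C)).hasDerivAt 0).const_mul X.det
  rw [Matrix.derivative_det_one_add_X_smul] at h2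
  have h3 := h2.congr_of_eventuallyEq (Filter.Eventually.of_forall h1)
  simpa using h3

section
attribute [local instance] Matrix.linftyOpNormedRing Matrix.linftyOpNormedAlgebra

theorem aux_inv_deriv {m : ℕ} (X w : Matrix (Fin m) (Fin m) ℝ) (hX : X.det ≠ 0) (i j : Fin m) :
    HasDerivAt (fun s : ℝ => (X - s • w)⁻¹ i j) ((X⁻¹ * w * X⁻¹) i j) 0 := by
  have hu : IsUnit X := (Matrix.isUnit_iff_isUnit_det X).2 (isUnit_iff_ne_zero.2 hX)
  obtain ⟨u, rfl⟩ := hu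
  have h1 : HasDerivAt (fun s : ℝ => (u : Matrix (Fin m) (Fin m) ℝ) - s • w) (-w) 0 := by
    exact (((hasDerivAt_id (0 : ℝ)).smul_const w).const_sub
      (u : Matrix (Fin m) (Fin m) ℝ)).congr_deriv (by simp)
  have h2 := hasFDerivAt_ringInverse (𝕜 := ℝ) u
  have h3 := HasFDerivAt.comp_hasDerivAt_of_eq (x := (0 : ℝ)) h2 h1 (by simp)
  let L : Matrix (Fin m) (Fin m) ℝ →L[ℝ] ℝ :=
    LinearMap.toContinuousLinearMap (Matrix.entryLinearMap ℝ ℝ i j)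
  have h4 := L.hasFDerivAt.comp_hasDerivAt (0 : ℝ) h3
  refine (h4.congr_deriv ?_).congr_of_eventuallyEq (Filter.Eventually.of_forall fun s => ?_)
  · simp [L, Matrix.coe_units_inv]
    rfl
  · simp [L, Matrix.nonsing_inv_eq_ringInverse]
end

theorem aux_ctp_deriv {n m : ℕ} (B : ℝ → Fin n → Matrix (Fin m) (Fin m) ℝ)
    (B' : Fin n → Matrix (Fin m) (Fin m) ℝ)
    (hB : ∀ l i j, HasDerivAt (fun s => B s l i j) (B' l i j) 0) (σ : Equiv.Perm (Fin n)) :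
    HasDerivAt (fun s => cycleTraceProd (B s) σ)
      (∑ j, cycleTraceProd (Function.update (B 0) j (B' j)) σ) 0 := by
  simp only [aux_ctp]
  rw [Finset.sum_comm]
  refine HasDerivAt.fun_sum fun k _ => ?_
  refine (HasDerivAt.fun_finsetProd fun l _ => hB l _ _).congr_deriv ?_
  refine Finset.sum_congr rfl fun j _ => ?_
  rw [← Finset.mul_prod_erase Finset.univ _ (Finset.mem_univ j), Function.update_self, smul_eq_mul,
    mul_comm]
  congr 1
  refine Finset.prod_congr rfl fun i hi => ?_
  rw [Function.update_of_ne (Finset.mem_erase.1 hi).1]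

theorem auxG_deriv {n m : ℕ} (p : ℝ) (B : ℝ → Fin n → Matrix (Fin m) (Fin m) ℝ)
    (B' : Fin n → Matrix (Fin m) (Fin m) ℝ)
    (hB : ∀ l i j, HasDerivAt (fun s => B s l i j) (B' l i j) 0) :
    HasDerivAt (fun s => auxG p (B s)) (∑ j, auxG p (Function.update (B 0) j (B' j))) 0 := by
  simp only [auxG]
  rw [Finset.sum_comm]
  refine HasDerivAt.fun_sum fun σ _ => ?_
  rw [← Finset.mul_sum]
  exact (aux_ctp_deriv B B' hB σ).const_mul _

theorem aux_main_deriv {n m : ℕ} (p : ℝ) (X w : Matrix (Fin m) (Fin m) ℝ) (hX : X.det ≠ 0)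
    (V : Fin n → Matrix (Fin m) (Fin m) ℝ) :
    HasDerivAt (fun s : ℝ => (X - s • w).det ^ (-p) * auxG p (fun j => (X - s • w)⁻¹ * V j))
      (X.det ^ (-p) * auxG p (fun j => X⁻¹ * (Fin.cons w V : Fin (n + 1) → _) j)) 0 := by
  have h0 : X - (0 : ℝ) • w = X := by simp
  have h1 := (aux_det_deriv X w hX).rpow_const (p := -p) (Or.inl (by rwa [h0]))
  have h2 := auxG_deriv p (fun s j => (X - s • w)⁻¹ * V j) (fun j => X⁻¹ * w * X⁻¹ * V j) (by
    intro l i j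
    simp only [Matrix.mul_apply (N := V l)]
    exact HasDerivAt.fun_sum fun c _ => (aux_inv_deriv X w hX i c).mul_const _)
  refine (h1.mul h2).congr_deriv ?_
  rw [auxG_succ]
  simp only [h0, Fin.cons_zero, Fin.cons_succ, Real.rpow_sub_one hX, ← mul_assoc]
  field_simp

theorem aux_main {n N m : ℕ} (p : ℝ) (a : Matrix (Fin m) (Fin m) ℝ)
    (v : Fin N → Matrix (Fin m) (Fin m) ℝ) (w : Fin n → Fin N → ℝ) (t : Fin N → ℝ)
    (ht : (-(a + ∑ j, t j • v j)).det ≠ 0) :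
    iteratedFDeriv ℝ n (fun t : Fin N → ℝ => ((-(a + ∑ j, t j • v j)).det) ^ (-p)) t w =
      (-(a + ∑ j, t j • v j)).det ^ (-p) *
        auxG p (fun i => (-(a + ∑ j, t j • v j))⁻¹ * ∑ j, w i j • v j) := by
  have hdet : ContDiff ℝ ⊤ (fun t : Fin N → ℝ => (-(a + ∑ j, t j • v j)).det) := by
    simp only [Matrix.det_apply, Matrix.neg_apply, Matrix.add_apply, Matrix.sum_apply,
      Matrix.smul_apply]
    fun_prop
  induction n generalizing t with
  | zero =>
    simp [auxG, cycleCount, cycleTraceProd, Equiv.Perm.cycleFactorsFinset_eq_empty_iff.2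
      (Subsingleton.elim _ _)]
  | succ n ih =>
    set F := (fun t : Fin N → ℝ => ((-(a + ∑ j, t j • v j)).det) ^ (-p)) with hF
    have hcd : ContDiffAt ℝ ((n + 1 : ℕ) : WithTop ℕ∞) F t :=
      (Real.contDiffAt_rpow_const_of_ne ht).comp t (hdet.contDiffAt.of_le le_top)
    have hdiff : DifferentiableAt ℝ (iteratedFDeriv ℝ n F) t :=
      hcd.differentiableAt_iteratedFDeriv (by exact_mod_cast Nat.lt_succ_self n)
    rw [iteratedFDeriv_succ_apply_left]
    have hline : HasDerivAt (fun s : ℝ => t + s • w 0) (w 0) 0 := by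
      simpa using ((hasDerivAt_id (0 : ℝ)).smul_const (w 0)).const_add t
    have h1 := HasFDerivAt.comp_hasDerivAt_of_eq (x := (0 : ℝ)) hdiff.hasFDerivAt hline (by simp)
    have h2 := ((ContinuousMultilinearMap.apply ℝ (fun _ : Fin n => Fin N → ℝ) ℝ
      (Fin.tail w)).hasFDerivAt).comp_hasDerivAt (0 : ℝ) h1
    have hXs : ∀ s : ℝ, -(a + ∑ j, (t + s • w 0) j • v j) =
        -(a + ∑ j, t j • v j) - s • ∑ j, w 0 j • v j := by
      intro s
      simp only [Pi.add_apply, Pi.smul_apply, smul_eq_mul, add_smul, Finset.sum_add_distrib,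
        mul_smul, ← Finset.smul_sum]
      abel
    have h3 := aux_main_deriv p _ (∑ j, w 0 j • v j) ht (fun i => ∑ j, Fin.tail w i j • v j)
    have hev : ∀ᶠ s : ℝ in nhds 0, (-(a + ∑ j, (t + s • w 0) j • v j)).det ≠ 0 := by
      have hc : ContinuousAt (fun s : ℝ => (-(a + ∑ j, (t + s • w 0) j • v j)).det) 0 :=
        (hdet.continuous.comp (by fun_prop : Continuous fun s : ℝ => t + s • w 0)).continuousAt
      exact hc.eventually_ne (by simpa using ht)
    have h4 := h2.congr_of_eventuallyEq (f₁ := _) (Filter.EventuallyEq.symm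
      (hev.mono fun s hs => (ih (Fin.tail w) (t + s • w 0) hs)))
    simp only [hXs] at h4
    refine (h4.unique h3).trans ?_
    congr 2
    funext i
    refine Fin.cases ?_ (fun i => ?_) i
    · simp
    · simp [Fin.tail]
/-- For `f(x) = det(-x)^{-p}` on the negative definite cone, the
iterated directional derivative `D_{v₁}⋯D_{v_N} f(a)` equals
`f(a) Σ_{σ ∈ S_N} p^{#C(σ)} ∏_{c ∈ C(σ)} tr(∏_{j ∈ c} (-a)⁻¹ v_j)`. -/
theorem iterated_dirDeriv_det_neg_rpow {m N : ℕ} (p : ℝ)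
    (a : Matrix (Fin m) (Fin m) ℝ) (ha : a.IsSymm) (hpos : (-a).PosDef)
    (v : Fin N → Matrix (Fin m) (Fin m) ℝ) (hv : ∀ j, (v j).IsSymm) :
    (iteratedFDeriv ℝ N
        (fun t : Fin N → ℝ => ((-(a + ∑ j, t j • v j)).det) ^ (-p)) 0)
        (fun j => Pi.single j (1 : ℝ))
      = ((-a).det ^ (-p)) *
          ∑ σ : Equiv.Perm (Fin N),
            p ^ cycleCount σ * cycleTraceProd (fun j => (-a)⁻¹ * v j) σ := by

  have h := aux_main (n := N) p a v (fun j => Pi.single j (1 : ℝ)) 0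
    (by simpa using hpos.det_pos.ne')
  rw [h, auxG]
  simp [Pi.single_apply]
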